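/- Let ρ be a strongly r-invariant probability measure on X and let V : X → [0,∞) be bounded and measurable. Then for every bounded measurable f : X → ℝ and every n ≥ 1, ∫_X V^{(n)}·f dρ = ∫_X R_V^n(f) dρ, where R_V^n denotes the n-fold iterate of the Ruelle operator R_V. -/

import Mathlib

open MeasureTheory Filter Topology Set

variable {X : Type*}

/-- The projective limit space `X_∞(r)`. -/
def SolSpace (r : X → X) : Type _ := {x : ℕ → X // ∀ n, r (x (n + 1)) = x n}

/-- Coordinate projection `θ_n`. -/
def theta (r : X → X) (n : ℕ) (x : SolSpace r) : X := x.1 n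

/-- The inverse shift `r̂⁻¹ (x₀,x₁,…) = (x₁,x₂,…)`. -/
def shiftInv (r : X → X) (x : SolSpace r) : SolSpace r :=
  ⟨fun n => x.1 (n + 1), fun n => x.2 (n + 1)⟩

/-- The shift `r̂ (x₀,x₁,…) = (r x₀, x₀, x₁, …)`. -/
def shift (r : X → X) (x : SolSpace r) : SolSpace r :=
  ⟨fun n => Nat.rec (r (x.1 0)) (fun k _ => x.1 k) n, by
    intro n
    cases n with
    | zero => rfl
    | succ k => exact x.2 k⟩

/-- The σ-algebra `ℬ_∞` generated by `⋃ n, ℬ_n` where `ℬ_n = θ_n⁻¹(ℬ)`. -/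
instance solMeasurableSpace (r : X → X) [MeasurableSpace X] :
    MeasurableSpace (SolSpace r) :=
  ⨆ n : ℕ, MeasurableSpace.comap (theta r n) inferInstance

/-- A function is bounded. -/
def IsBdd {α : Type*} (f : α → ℝ) : Prop := ∃ C : ℝ, ∀ x, |f x| ≤ C

/-- The Ruelle transfer operator `R_V`. -/
noncomputable def ruelle (r : X → X) (hfin : ∀ x : X, (r ⁻¹' {x}).Finite)
    (V : X → ℝ) (f : X → ℝ) (x : X) : ℝ :=
  (∑ y ∈ (hfin x).toFinset, V y * f y) / ((hfin x).toFinset.card : ℝ)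

/-- Strong `r`-invariance of a measure `ρ`. -/
def StronglyInvariant (r : X → X) (hfin : ∀ x : X, (r ⁻¹' {x}).Finite)
    [MeasurableSpace X] (ρ : Measure X) : Prop :=
  ∀ f : X → ℝ, Measurable f → IsBdd f →
    ∫ x, f x ∂ρ =
      ∫ x, (∑ y ∈ (hfin x).toFinset, f y) / ((hfin x).toFinset.card : ℝ) ∂ρ

/-- The transformation of measures `T_V(μ) = (V dμ) ∘ r⁻¹`. -/
noncomputable def TV (r : X → X) [MeasurableSpace X] (V : X → ℝ) (μ : Measure X) :
    Measure X :=
  Measure.map r (μ.withDensity fun x => ENNReal.ofReal (V x))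

/-- `V^{(n)} = V · (V∘r) ⋯ (V∘r^{n-1})`. -/
def Vpow (r : X → X) (V : X → ℝ) (n : ℕ) (x : X) : ℝ :=
  ∏ k ∈ Finset.range n, V (r^[k] x)

lemma avg_bdd (r : X → X) (hfin : ∀ x : X, (r ⁻¹' {x}).Finite) (f : X → ℝ) (C : ℝ)
    (hC : ∀ x, |f x| ≤ C) (x : X) :
    |(∑ y ∈ (hfin x).toFinset, f y) / ((hfin x).toFinset.card : ℝ)| ≤ C := by
  have h0 : 0 ≤ C := (abs_nonneg _).trans (hC x)
  rw [abs_div, Nat.abs_cast]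
  refine div_le_of_le_mul₀ (Nat.cast_nonneg _) h0 ?_
  refine (Finset.abs_sum_le_sum_abs _ _).trans ?_
  refine (Finset.sum_le_sum (fun y _ => hC y)).trans ?_
  simp [mul_comm]

lemma card_ne (r : X → X) (hsurj : Function.Surjective r)
    (hfin : ∀ x : X, (r ⁻¹' {x}).Finite) (x : X) :
    ((hfin x).toFinset.card : ℝ) ≠ 0 := by
  obtain ⟨y, hy⟩ := hsurj x
  have : y ∈ (hfin x).toFinset := by simp [hy]
  exact_mod_cast (Finset.card_pos.mpr ⟨y, this⟩).ne'

lemma avg_integrable [MeasurableSpace X]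
    (r : X → X) (hsurj : Function.Surjective r)
    (hfin : ∀ x : X, (r ⁻¹' {x}).Finite)
    (ρ : Measure X) [IsProbabilityMeasure ρ] (hinv : StronglyInvariant r hfin ρ)
    (f : X → ℝ) (hf : Measurable f) (hfb : IsBdd f) :
    Integrable (fun x => (∑ y ∈ (hfin x).toFinset, f y) / ((hfin x).toFinset.card : ℝ)) ρ := by
  by_contra hn
  have h1 := hinv f hf hfb
  rw [integral_undef hn] at h1
  obtain ⟨C, hC⟩ := hfb
  have h2 := hinv (fun x => f x + 1) (hf.add_const 1)
    ⟨C + 1, fun x => (abs_add_le _ _).trans (by simpa using hC x)⟩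
  have he : (fun x => (∑ y ∈ (hfin x).toFinset, (f y + 1)) / ((hfin x).toFinset.card : ℝ))
      = fun x => (∑ y ∈ (hfin x).toFinset, f y) / ((hfin x).toFinset.card : ℝ) + 1 := by
    funext x
    have := card_ne r hsurj hfin x
    rw [Finset.sum_add_distrib, add_div]
    simp only [Finset.sum_const, nsmul_eq_mul, mul_one]
    rw [div_self this]
  have hfi : Integrable f ρ :=
    Integrable.of_bound hf.aestronglyMeasurable C (Eventually.of_forall hC)
  have hn2 : ¬ Integrable
      (fun x => (∑ y ∈ (hfin x).toFinset, f y) / ((hfin x).toFinset.card : ℝ) + 1) ρ := by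
    intro h
    apply hn
    refine (h.sub (integrable_const (1 : ℝ))).congr (Eventually.of_forall fun x => ?_)
    simp
  rw [he, integral_undef hn2, integral_add hfi (integrable_const _), h1] at h2
  simp at h2

lemma ae_fiber [MeasurableSpace X]
    (r : X → X) (hsurj : Function.Surjective r)
    (hfin : ∀ x : X, (r ⁻¹' {x}).Finite)
    (ρ : Measure X) [IsProbabilityMeasure ρ] (hinv : StronglyInvariant r hfin ρ)
    (u v : X → ℝ) (h : u =ᵐ[ρ] v) :
    ∀ᵐ x ∂ρ, ∀ y ∈ (hfin x).toFinset, u y = v y := by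
  classical
  obtain ⟨N, hsub, hN, hN0⟩ := exists_measurable_superset_of_null (ae_iff.mp h)
  have hm : Measurable (N.indicator (fun _ => (1 : ℝ))) := measurable_const.indicator hN
  have hnn : ∀ y, 0 ≤ N.indicator (fun _ => (1 : ℝ)) y :=
    fun y => indicator_nonneg (fun _ _ => zero_le_one) y
  have hb : IsBdd (N.indicator (fun _ => (1 : ℝ))) := ⟨1, fun x => by
    by_cases hx : x ∈ N <;> simp [hx]⟩
  have h1 := hinv _ hm hb
  have h2 : ∫ x, N.indicator (fun _ => (1 : ℝ)) x ∂ρ = 0 := by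
    rw [integral_indicator hN, Measure.restrict_eq_zero.mpr hN0]; simp
  rw [h2] at h1
  have h3 := (integral_eq_zero_iff_of_nonneg
    (fun x => div_nonneg (Finset.sum_nonneg (fun y _ => hnn y)) (Nat.cast_nonneg _))
    (avg_integrable r hsurj hfin ρ hinv _ hm hb)).mp h1.symm
  filter_upwards [h3] with x hx y hy
  have h4 := (div_eq_zero_iff.mp hx).resolve_right (card_ne r hsurj hfin x)
  have h5 := (Finset.sum_eq_zero_iff_of_nonneg (fun y _ => hnn y)).mp h4 y hy
  by_contra hne
  have : y ∈ N := hsub hne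
  simp [this] at h5

lemma ruelle_iter_congr [MeasurableSpace X]
    (r : X → X) (hsurj : Function.Surjective r)
    (hfin : ∀ x : X, (r ⁻¹' {x}).Finite)
    (ρ : Measure X) [IsProbabilityMeasure ρ] (hinv : StronglyInvariant r hfin ρ)
    (V : X → ℝ) (n : ℕ) : ∀ (u v : X → ℝ), u =ᵐ[ρ] v →
    (ruelle r hfin V)^[n] u =ᵐ[ρ] (ruelle r hfin V)^[n] v := by
  induction n with
  | zero => intro u v h; exact h
  | succ n ih =>
    intro u v h
    rw [Function.iterate_succ_apply, Function.iterate_succ_apply]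
    apply ih
    filter_upwards [ae_fiber r hsurj hfin ρ hinv u v h] with x hx
    unfold ruelle
    rw [Finset.sum_congr rfl (fun y hy => by rw [hx y hy])]

lemma vpow_succ (r : X → X) (V : X → ℝ) (n : ℕ) (x : X) :
    Vpow r V (n + 1) x = V x * Vpow r V n (r x) := by
  simp [Vpow, Finset.prod_range_succ', mul_comm]

lemma vpow_bdd (r : X → X) (V : X → ℝ) (hVb : IsBdd V) (n : ℕ) : IsBdd (Vpow r V n) := by
  obtain ⟨C, hC⟩ := hVb
  refine ⟨∏ k ∈ Finset.range n, C, fun x => ?_⟩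
  rw [Vpow, Finset.abs_prod]
  exact Finset.prod_le_prod (fun _ _ => abs_nonneg _) (fun _ _ => hC _)

lemma bdd_mul (f g : X → ℝ) (hf : IsBdd f) (hg : IsBdd g) : IsBdd (fun x => f x * g x) := by
  obtain ⟨C, hC⟩ := hf
  obtain ⟨D, hD⟩ := hg
  refine ⟨C * D, fun x => ?_⟩
  rw [abs_mul]
  exact mul_le_mul (hC x) (hD x) (abs_nonneg _) ((abs_nonneg _).trans (hC x))

lemma main_aux [MeasurableSpace X]
    (r : X → X) (hr : Measurable r) (hsurj : Function.Surjective r)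
    (hfin : ∀ x : X, (r ⁻¹' {x}).Finite)
    (ρ : Measure X) [IsProbabilityMeasure ρ] (hinv : StronglyInvariant r hfin ρ)
    (V : X → ℝ) (hV : Measurable V) (hVb : IsBdd V) (n : ℕ) :
    ∀ f : X → ℝ, Measurable f → IsBdd f →
      ∫ x, Vpow r V n x * f x ∂ρ = ∫ x, (ruelle r hfin V)^[n] f x ∂ρ := by
  induction n with
  | zero => intro f _ _; simp [Vpow]
  | succ n ih =>
    intro f hf hfb
    have hvm : Measurable (Vpow r V (n + 1)) := by
      unfold Vpow
      exact Finset.measurable_prod _ (fun k _ => hV.comp (hr.iterate k))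
    have hvf := bdd_mul V f hVb hfb
    have hint : Integrable (ruelle r hfin V f) ρ :=
      avg_integrable r hsurj hfin ρ hinv _ (hV.mul hf) hvf
    obtain ⟨C, hC⟩ := hvf
    have hRb : ∀ x, |ruelle r hfin V f x| ≤ C := avg_bdd r hfin _ C hC
    obtain ⟨g0, hg0, hg0e⟩ := hint.aestronglyMeasurable
    set g : X → ℝ := fun x => max (-C) (min C (g0 x)) with hg
    have hgm : Measurable g := measurable_const.max (measurable_const.min hg0.measurable)
    have hge : ruelle r hfin V f =ᵐ[ρ] g := by
      filter_upwards [hg0e] with x hx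
      have := abs_le.mp (hRb x)
      rw [hg]
      simp only
      rw [← hx, min_eq_right this.2, max_eq_right this.1]
    have hgb : IsBdd g := ⟨C, fun x => by
      have h0 : 0 ≤ C := (abs_nonneg _).trans (hC x)
      exact abs_le.mpr ⟨le_max_left _ _, max_le (by linarith) (min_le_left _ _)⟩⟩
    rw [hinv (fun x => Vpow r V (n + 1) x * f x) (hvm.mul hf) (bdd_mul _ _ (vpow_bdd r V hVb _) hfb)]
    have e1 : ∀ x, (∑ y ∈ (hfin x).toFinset, Vpow r V (n + 1) y * f y)
        / ((hfin x).toFinset.card : ℝ) = Vpow r V n x * ruelle r hfin V f x := by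
      intro x
      rw [ruelle, ← mul_div_assoc, Finset.mul_sum]
      congr 1
      refine Finset.sum_congr rfl (fun y hy => ?_)
      have hy' : r y = x := by simpa using hy
      rw [vpow_succ, hy']
      ring
    rw [integral_congr_ae (Eventually.of_forall e1)]
    have e2 : (fun x => Vpow r V n x * ruelle r hfin V f x) =ᵐ[ρ]
        fun x => Vpow r V n x * g x := by
      filter_upwards [hge] with x hx
      rw [hx]
    rw [integral_congr_ae e2, ih g hgm hgb, Function.iterate_succ_apply]
    exact integral_congr_ae (ruelle_iter_congr r hsurj hfin ρ hinv V n _ _ hge.symm)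

/-- Lemma 6.6: `∫ V⁽ⁿ⁾·f dρ = ∫ R_Vⁿ(f) dρ` for all bounded measurable `f` and `n ≥ 1`. -/
theorem stmt13 [MeasurableSpace X] [TopologicalSpace X] [CompactSpace X] [T2Space X]
    [BorelSpace X]
    (r : X → X) (hr : Continuous r) (hsurj : Function.Surjective r)
    (hfin : ∀ x : X, (r ⁻¹' {x}).Finite)
    (ρ : Measure X) [IsProbabilityMeasure ρ] (hinv : StronglyInvariant r hfin ρ)
    (V : X → ℝ) (hV : Measurable V) (hVb : IsBdd V) (hVpos : ∀ x, 0 ≤ V x) :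
    ∀ n : ℕ, 1 ≤ n → ∀ f : X → ℝ, Measurable f → IsBdd f →
      ∫ x, Vpow r V n x * f x ∂ρ = ∫ x, (ruelle r hfin V)^[n] f x ∂ρ := by
  intro n _ f hf hfb
  exact main_aux r hr.measurable hsurj hfin ρ hinv V hV hVb n f hf hfb
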